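/- Fix distinct points z₁, …, zₙ ∈ ℂ and m ∈ {1, …, n−1}. Then there exists a constant C > 0, depending only on n, m and z₁, …, zₙ, such that R(Z,r,m) = 1 − C r² + O(r³) as r → 0⁺; that is, there exist M > 0 and r₀ > 0 such that |R(Z,r,m) − (1 − C r²)| ≤ M r³ for all 0 < r < r₀. -/

import Mathlib

open Complex Filter Metric Set Topology Bornology MeasureTheory

noncomputable section

/-- `f` has value `l` at infinity and derivative `w` at infinity (within the set `s`), i.e.
`f(z) → l` and `z (f(z) - l) → w` as `z → ∞` within `s`. -/
def HasDerivAtInftyOn (f : ℂ → ℂ) (s : Set ℂ) (l w : ℂ) : Prop :=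
  Tendsto f (cobounded ℂ ⊓ 𝓟 s) (𝓝 l) ∧
    Tendsto (fun z => z * (f z - l)) (cobounded ℂ ⊓ 𝓟 s) (𝓝 w)

/-- The analytic capacity of a plane set `K`:
`γ(K) = sup { |f′(∞)| : f` holomorphic on `ℂ∞ ∖ K`, `‖f‖ ≤ 1 }`. -/
def analyticCapacity (K : Set ℂ) : ℝ :=
  sSup { r : ℝ | ∃ (f : ℂ → ℂ) (l w : ℂ),
    DifferentiableOn ℂ f Kᶜ ∧ (∀ z ∈ Kᶜ, ‖f z‖ ≤ 1) ∧
    HasDerivAtInftyOn f Kᶜ l w ∧ r = ‖w‖ }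

/-- The Cauchy transform of a function on a circle. -/
def cauchyT (g : ℂ → ℂ) (c : ℂ) (ρ : ℝ) (x : ℂ) : ℂ := ∮ ζ in C(c, ρ), g ζ / (x - ζ)

lemma cauchyT_differentiableAt {g : ℂ → ℂ} {c : ℂ} {ρ : ℝ} (hρ : 0 ≤ ρ)
    (hg : ContinuousOn g (sphere c ρ)) {x : ℂ} (hx : x ∉ sphere c ρ) :
    DifferentiableAt ℂ (cauchyT g c ρ) x := by
  obtain ⟨ε, hε, hball⟩ := Metric.isOpen_iff.1 (isClosed_sphere (x := c) (ε := ρ)).isOpen_compl x hx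
  obtain ⟨B, hB⟩ := (isCompact_sphere c ρ).exists_bound_of_continuousOn hg
  have hmem : ∀ θ, circleMap c ρ θ ∈ sphere c ρ := fun θ => circleMap_mem_sphere c hρ θ
  have hfar : ∀ y ∈ ball x (ε/2), ∀ ζ ∈ sphere c ρ, ε/2 ≤ ‖y - ζ‖ := by
    intro y hy ζ hζ
    by_contra! h
    have : ζ ∈ ball x ε := by
      rw [mem_ball, dist_eq_norm] at *
      calc ‖ζ - x‖ = ‖(y - x) - (y - ζ)‖ := by ring_nf
        _ ≤ ‖y - x‖ + ‖y - ζ‖ := norm_sub_le _ _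
        _ < ε := by linarith
    exact hball this hζ
  have hne : ∀ y ∈ ball x (ε/2), ∀ ζ ∈ sphere c ρ, y - ζ ≠ 0 := by
    intro y hy ζ hζ h
    have := hfar y hy ζ hζ
    rw [h, norm_zero] at this
    linarith
  have hcg : Continuous (fun θ => g (circleMap c ρ θ)) :=
    hg.comp_continuous (continuous_circleMap c ρ) hmem
  have hcd : Continuous (fun θ => deriv (circleMap c ρ) θ) := by
    simp only [deriv_circleMap]; fun_prop
  have hcont : ∀ y ∈ ball x (ε/2), Continuous (fun θ =>
      deriv (circleMap c ρ) θ • (g (circleMap c ρ θ) / (y - circleMap c ρ θ))) := fun y hy =>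
    hcd.smul (hcg.div (continuous_const.sub (continuous_circleMap c ρ)) fun θ =>
      hne y hy _ (hmem θ))
  have hx0 : x ∈ ball x (ε/2) := mem_ball_self (by linarith)
  have key := intervalIntegral.hasDerivAt_integral_of_dominated_loc_of_deriv_le (𝕜 := ℂ)
    (μ := volume) (a := 0) (b := 2 * Real.pi) (x₀ := x) (s := ball x (ε/2))
    (F := fun y θ => deriv (circleMap c ρ) θ • (g (circleMap c ρ θ) / (y - circleMap c ρ θ)))
    (F' := fun y θ => deriv (circleMap c ρ) θ •
      (- g (circleMap c ρ θ) / (y - circleMap c ρ θ)^2))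
    (bound := fun _ => ρ * (B / (ε/2)^2))
    (ball_mem_nhds x (by linarith))
    (by
      filter_upwards [ball_mem_nhds x (show 0 < ε/2 by linarith)] with y hy
      exact (hcont y hy).aestronglyMeasurable)
    ((hcont x hx0).intervalIntegrable _ _)
    (by
      refine Continuous.aestronglyMeasurable ?_
      exact hcd.smul (hcg.neg.div ((continuous_const.sub (continuous_circleMap c ρ)).pow 2)
        fun θ => pow_ne_zero 2 (hne x hx0 _ (hmem θ))))
    (by
      refine Filter.Eventually.of_forall fun θ _ y hy => ?_
      have h1 := hfar y hy _ (hmem θ)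
      have h2 := hB _ (hmem θ)
      have h3 : ‖deriv (circleMap c ρ) θ‖ = ρ := by
        simp [deriv_circleMap, abs_of_nonneg hρ]
      rw [norm_smul, h3, norm_div, norm_neg, norm_pow]
      have : 0 ≤ B := (norm_nonneg _).trans h2
      gcongr)
    (by simp)
    (by
      refine Filter.Eventually.of_forall fun θ _ y hy => ?_
      have h := hne y hy _ (hmem θ)
      have h1 : HasDerivAt (fun y => g (circleMap c ρ θ) / (y - circleMap c ρ θ))
        (- g (circleMap c ρ θ) / (y - circleMap c ρ θ)^2) y := by
        have := (hasDerivAt_const y (g (circleMap c ρ θ))).div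
          ((hasDerivAt_id y).sub_const (circleMap c ρ θ)) h
        simpa using! this
      exact h1.fun_const_smul _)
  exact key.2.differentiableAt

lemma cauchyT_tendsto {g : ℂ → ℂ} {c : ℂ} {ρ : ℝ} (hρ : 0 ≤ ρ)
    (hg : ContinuousOn g (sphere c ρ)) :
    Tendsto (cauchyT g c ρ) (cobounded ℂ) (𝓝 0) := by
  obtain ⟨B, hB⟩ := (isCompact_sphere c ρ).exists_bound_of_continuousOn hg
  have hT : Tendsto (fun x : ℂ => ‖x‖ - ‖c‖ - ρ) (cobounded ℂ) atTop := by
    have := tendsto_atTop_add_const_right _ (-‖c‖ - ρ) (tendsto_norm_cobounded_atTop (E := ℂ))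
    refine this.congr fun x => by ring
  have h0 : Tendsto (fun x : ℂ => 2 * Real.pi * ρ * (B / (‖x‖ - ‖c‖ - ρ))) (cobounded ℂ)
      (𝓝 0) := by
    have := (hT.const_div_atTop B).const_mul (2 * Real.pi * ρ)
    simpa using this
  refine squeeze_zero_norm' ?_ h0
  filter_upwards [hT.eventually_gt_atTop 0] with x hx
  refine circleIntegral.norm_integral_le_of_norm_le_const hρ fun ζ hζ => ?_
  have h2 := hB _ hζ
  have : 0 ≤ B := (norm_nonneg _).trans h2
  have h3 : ‖x‖ - ‖c‖ - ρ ≤ ‖x - ζ‖ := by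
    have h4 : ‖ζ - c‖ = ρ := by simpa [dist_eq_norm] using hζ
    have h5 : ‖x‖ ≤ ‖x - ζ‖ + ‖ζ - c‖ + ‖c‖ := by
      calc ‖x‖ = ‖(x - ζ) + (ζ - c) + c‖ := by ring_nf
        _ ≤ _ := (norm_add_le _ _).trans (by gcongr; exact norm_add_le _ _)
    linarith
  rw [norm_div]
  gcongr

lemma cauchyT_mul_tendsto {g : ℂ → ℂ} {c : ℂ} {ρ : ℝ} (hρ : 0 ≤ ρ)
    (hg : ContinuousOn g (sphere c ρ)) :
    Tendsto (fun x => x * cauchyT g c ρ x) (cobounded ℂ) (𝓝 (∮ ζ in C(c, ρ), g ζ)) := by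
  have h1 := cauchyT_tendsto hρ (g := fun ζ => ζ * g ζ) (continuousOn_id.mul hg)
  have h2 := (tendsto_const_nhds (x := ∮ ζ in C(c, ρ), g ζ)).add h1
  rw [add_zero] at h2
  refine h2.congr' ?_
  have : (sphere c ρ)ᶜ ∈ cobounded ℂ := by
    rw [← Bornology.isBounded_def]; exact isBounded_sphere
  filter_upwards [this] with x hx
  have hne : ∀ ζ ∈ sphere c ρ, x - ζ ≠ 0 := by
    intro ζ hζ h
    rw [sub_eq_zero] at h
    exact hx (h ▸ hζ)
  unfold cauchyT
  rw [← circleIntegral.integral_add (hg.circleIntegrable hρ), ← circleIntegral.integral_const_mul]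
  · refine circleIntegral.integral_congr hρ fun ζ hζ => ?_
    have := hne ζ hζ
    simp only
    field_simp
    ring
  · refine ContinuousOn.circleIntegrable hρ ?_
    exact (continuousOn_id.mul hg).div (continuousOn_const.sub continuousOn_id) hne

/-- Laurent decomposition on an annulus. -/
lemma laurent_annulus {F : ℂ → ℂ} {c : ℂ} {r ρ R : ℝ} (hr : 0 < r) (hrρ : r < ρ) 
    {V : Set ℂ} (hV : IsOpen V) (hVs : closedBall c R \ closedBall c r ⊆ V)
    (hF : DifferentiableOn ℂ F V) {x : ℂ}
    (hx1 : ρ < dist x c) (hx2 : dist x c < R) :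
    F x = (2 * Real.pi * I)⁻¹ * (cauchyT F c ρ x - cauchyT F c R x) := by
  have hρ : 0 < ρ := hr.trans hrρ
  have hR : 0 < R := by linarith
  have hsub : closedBall c R \ ball c ρ ⊆ V := by
    intro y hy
    refine hVs ⟨hy.1, fun h => hy.2 ?_⟩
    exact lt_of_le_of_lt (mem_closedBall.1 h) hrρ
  have hxV : x ∈ V := hsub ⟨hx2.le, fun h => by rw [mem_ball] at h; linarith⟩
  have hdx : DifferentiableAt ℂ F x := hF.differentiableAt (hV.mem_nhds hxV)
  have hcont : ContinuousOn (dslope F x) V :=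
    (continuousOn_dslope (hV.mem_nhds hxV)).2 ⟨hF.continuousOn, hdx⟩
  have hann := Complex.circleIntegral_eq_of_differentiable_on_annulus_off_countable (c := c)
    (r := ρ) (R := R) hρ (by linarith) (f := dslope F x) (s := {x}) (countable_singleton x)
    (hcont.mono hsub) (by
      intro y hy
      have hyx : y ≠ x := hy.2
      refine (differentiableAt_dslope_of_ne hyx).2 (hF.differentiableAt (hV.mem_nhds (hsub ?_)))
      exact ⟨ball_subset_closedBall hy.1.1, fun h => hy.1.2 (ball_subset_closedBall h)⟩)
  have hcomp : ∀ t, 0 < t → t ≠ dist x c → sphere c t ⊆ V →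
      (∮ ζ in C(c, t), dslope F x ζ) = - cauchyT F c t x -
        F x * ∮ ζ in C(c, t), (ζ - x)⁻¹ := by
    intro t ht htx htV
    have hne : ∀ ζ ∈ sphere c t, ζ - x ≠ 0 := by
      intro ζ hζ h
      rw [sub_eq_zero] at h
      rw [h, mem_sphere] at hζ
      exact htx hζ.symm
    have hi1 : CircleIntegrable (fun ζ => F ζ / (x - ζ)) c t := by
      refine ContinuousOn.circleIntegrable ht.le ?_
      refine (hF.continuousOn.mono htV).div (continuousOn_const.sub continuousOn_id) ?_
      intro ζ hζ h
      exact hne ζ hζ (by rw [← neg_sub, h, neg_zero])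
    have hi2 : CircleIntegrable (fun ζ => (ζ - x)⁻¹) c t := by
      refine ContinuousOn.circleIntegrable ht.le ?_
      exact (continuousOn_id.sub continuousOn_const).inv₀ hne
    have h1 : (∮ ζ in C(c, t), dslope F x ζ) =
      ∮ ζ in C(c, t), ((-1) * (F ζ / (x - ζ)) - F x * (ζ - x)⁻¹) := by
      refine circleIntegral.integral_congr ht.le fun ζ hζ => ?_
      have h := hne ζ hζ
      have h' : x - ζ ≠ 0 := fun h'' => h (by rw [← neg_sub, h'', neg_zero])
      rw [dslope_of_ne _ (sub_ne_zero.1 h), slope_def_field]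
      have h3 : x - ζ = - (ζ - x) := by ring
      rw [h3, div_neg]
      field_simp
    have hi1' : CircleIntegrable (fun ζ => (-1 : ℂ) * (F ζ / (x - ζ))) c t :=
      hi1.const_smul (a := (-1:ℂ))
    have hi2' : CircleIntegrable (fun ζ => F x * (ζ - x)⁻¹) c t := hi2.const_smul (a := F x)
    rw [h1, circleIntegral.integral_sub hi1' hi2',
      circleIntegral.integral_const_mul, circleIntegral.integral_const_mul]
    unfold cauchyT
    ring
  rw [hcomp R hR hx2.ne' ((fun y hy => hsub ⟨sphere_subset_closedBall hy, fun h => by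
      rw [mem_sphere] at hy; rw [mem_ball] at h; linarith⟩)),
    hcomp ρ hρ hx1.ne ((fun y hy => hsub ⟨by
      rw [mem_sphere] at hy; rw [mem_closedBall]; linarith, fun h => by
      rw [mem_sphere] at hy; rw [mem_ball] at h; linarith⟩)),
    circleIntegral.integral_sub_inv_of_mem_ball (mem_ball.2 hx2)] at hann
  have hz : (∮ ζ in C(c, ρ), (ζ - x)⁻¹) = 0 := by
    refine Complex.circleIntegral_eq_zero_of_differentiable_on_off_countable hρ.le
      countable_empty ?_ ?_
    · refine (continuousOn_id.sub continuousOn_const).inv₀ ?_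
      intro ζ hζ h
      replace h : ζ - x = 0 := h
      rw [sub_eq_zero] at h
      rw [h, mem_closedBall] at hζ
      linarith
    · intro ζ hζ
      have : ζ - x ≠ 0 := by
        intro h
        rw [sub_eq_zero] at h
        have := mem_ball.1 hζ.1
        rw [h] at this
        linarith
      fun_prop (disch := assumption)
  rw [hz] at hann
  have hpi : (2 * Real.pi * I : ℂ) ≠ 0 := by
    simp [Real.pi_ne_zero]
  field_simp
  linear_combination (-1) * hann

lemma cauchy_residue {ι : Type*} [Fintype ι] (z : ι → ℂ) {r ρ R : ℝ} (hr : 0 < r) (hrρ : r < ρ)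
    (hρR : ρ < R) (hd : ∀ j k, j ≠ k → 2 * R ≤ dist (z j) (z k)) (F : ℂ → ℂ)
    (hF : DifferentiableOn ℂ F (⋃ j, closedBall (z j) r)ᶜ) (l w : ℂ)
    (h1 : Tendsto F (cobounded ℂ) (𝓝 l))
    (h2 : Tendsto (fun x => x * (F x - l)) (cobounded ℂ) (𝓝 w)) :
    w = ∑ j, (2 * Real.pi * I)⁻¹ * ∮ ζ in C(z j, ρ), F ζ := by
  classical
  have hρ : 0 < ρ := hr.trans hrρ
  have hR : 0 < R := by linarith
  have hV : IsOpen (⋃ j, closedBall (z j) r)ᶜ :=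
    (isClosed_iUnion_of_finite fun j => isClosed_closedBall).isOpen_compl
  set V := (⋃ j, closedBall (z j) r)ᶜ with hVdef
  have hann : ∀ j, closedBall (z j) R \ closedBall (z j) r ⊆ V := by
    intro j y hy
    simp only [hVdef, mem_compl_iff, mem_iUnion, not_exists]
    intro k hk
    by_cases hjk : j = k
    · subst hjk; exact hy.2 hk
    · have := hd j k hjk
      have h3 := dist_triangle_left (z j) (z k) y
      have h4 := mem_closedBall.1 hk
      have h5 := mem_closedBall.1 hy.1
      linarith
  have hsphV : ∀ j t, r < t → t ≤ R → sphere (z j) t ⊆ V := by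
    intro j t h h' y hy
    rw [mem_sphere] at hy
    refine hann j ⟨by rw [mem_closedBall]; linarith, ?_⟩
    rw [mem_closedBall]; linarith
  have hgρ : ∀ j, ContinuousOn F (sphere (z j) ρ) := fun j =>
    hF.continuousOn.mono (hsphV j ρ hrρ hρR.le)
  have hgR : ∀ j, ContinuousOn F (sphere (z j) R) := fun j =>
    hF.continuousOn.mono (hsphV j R (by linarith) le_rfl)
  set κ : ℂ := (2 * Real.pi * I)⁻¹ with hκ
  -- the outer part
  let E : ℂ → ℂ := fun x => F x - ∑ j, κ * cauchyT F (z j) ρ x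
  let J : ι → ℂ → ℂ := fun j x => - κ * cauchyT F (z j) R x
    - ∑ k ∈ Finset.univ.erase j, κ * cauchyT F (z k) ρ x
  let G : ℂ → ℂ := fun x => if h : ∃ j, x ∈ ball (z j) R then J h.choose x else E x
  have huniq : ∀ j k x, x ∈ ball (z j) R → x ∈ ball (z k) R → j = k := by
    intro j k x hj hk
    by_contra hjk
    have := hd j k hjk
    have h3 := dist_triangle_left (z j) (z k) x
    have h4 := mem_ball.1 hk
    have h5 := mem_ball.1 hj
    linarith
  have hGin : ∀ j x, x ∈ ball (z j) R → G x = J j x := by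
    intro j x hx
    have h : ∃ j, x ∈ ball (z j) R := ⟨j, hx⟩
    simp only [G, dif_pos h]
    rw [huniq _ _ x h.choose_spec hx]
  have hGout : ∀ x, (∀ j, ρ < dist x (z j)) → G x = E x := by
    intro x hx
    by_cases h : ∃ j, x ∈ ball (z j) R
    · obtain ⟨j, hj⟩ := h
      rw [hGin j x hj]
      have := laurent_annulus hr hrρ hV (hann j) hF (hx j) hj
      simp only [J, E]
      rw [this, ← Finset.add_sum_erase _ _ (Finset.mem_univ j)]
      ring
    · simp only [G, dif_neg h]
  have hdist : ∀ j x, x ∉ sphere (z j) ρ → DifferentiableAt ℂ (cauchyT F (z j) ρ) x :=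
    fun j x hx => cauchyT_differentiableAt hρ.le (hgρ j) hx
  have hGd : Differentiable ℂ G := by
    intro x
    by_cases h : ∃ j, x ∈ ball (z j) R
    · obtain ⟨j, hj⟩ := h
      have hev : G =ᶠ[𝓝 x] J j := by
        filter_upwards [isOpen_ball.mem_nhds hj] with y hy using hGin j y hy
      refine DifferentiableAt.congr_of_eventuallyEq ?_ hev
      refine DifferentiableAt.sub ?_ ?_
      · refine DifferentiableAt.const_mul ?_ _
        refine cauchyT_differentiableAt hR.le (hgR j) ?_
        rw [mem_sphere]; exact (mem_ball.1 hj).ne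
      · refine DifferentiableAt.fun_sum fun k hk => ?_
        refine (hdist k x fun hx => ?_).const_mul _
        have hx' : x ∈ ball (z k) R := by
          rw [mem_sphere] at hx; rw [mem_ball]; linarith
        exact (Finset.ne_of_mem_erase hk) (huniq k j x hx' hj)
    · push Not at h
      have hx : x ∈ (⋃ j, closedBall (z j) ρ)ᶜ := by
        simp only [mem_compl_iff, mem_iUnion, not_exists]
        intro k hk
        exact h k (lt_of_le_of_lt hk hρR)
      have hop : IsOpen (⋃ j, closedBall (z j) ρ)ᶜ :=
        (isClosed_iUnion_of_finite fun j => isClosed_closedBall).isOpen_compl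
      have hev : G =ᶠ[𝓝 x] E := by
        filter_upwards [hop.mem_nhds hx] with y hy
        refine hGout y fun j => ?_
        simp only [mem_compl_iff, mem_iUnion, not_exists, mem_closedBall, not_le] at hy
        exact hy j
      refine DifferentiableAt.congr_of_eventuallyEq ?_ hev
      simp only [mem_compl_iff, mem_iUnion, not_exists, mem_closedBall, not_le] at hx
      refine DifferentiableAt.sub ?_ ?_
      · refine hF.differentiableAt (hV.mem_nhds ?_)
        simp only [hVdef, mem_compl_iff, mem_iUnion, not_exists, mem_closedBall, not_le]
        intro k; linarith [hx k]
      · refine DifferentiableAt.fun_sum fun k hk => ?_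
        refine (hdist k x fun hx' => ?_).const_mul _
        rw [mem_sphere] at hx'
        linarith [hx k]
  have hfar : ∀ᶠ x in cobounded ℂ, ∀ j, ρ < dist x (z j) := by
    rw [eventually_all]
    intro j
    have : (closedBall (z j) ρ)ᶜ ∈ cobounded ℂ := by
      rw [← Bornology.isBounded_def]; exact isBounded_closedBall
    filter_upwards [this] with x hx
    simpa using hx
  have hsum0 : Tendsto (fun x => ∑ j, κ * cauchyT F (z j) ρ x) (cobounded ℂ) (𝓝 0) := by
    have := tendsto_finsetSum (Finset.univ) fun j _ =>
      (cauchyT_tendsto hρ.le (hgρ j)).const_mul κ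
    simpa using this
  have hGlim : Tendsto G (cobounded ℂ) (𝓝 l) := by
    have h3 := h1.sub hsum0
    rw [sub_zero] at h3
    refine h3.congr' ?_
    filter_upwards [hfar] with x hx using (hGout x hx).symm
  have hGl : ∀ x, G x = l := by
    intro x
    refine hGd.apply_eq_of_tendsto_cocompact x ?_
    rwa [← Metric.cobounded_eq_cocompact]
  have hlim : Tendsto (fun x => x * (F x - l)) (cobounded ℂ)
      (𝓝 (∑ j, κ * ∮ ζ in C(z j, ρ), F ζ)) := by
    have h3 := tendsto_finsetSum (Finset.univ) fun j _ =>
      (cauchyT_mul_tendsto hρ.le (hgρ j)).const_mul κ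
    refine h3.congr' ?_
    filter_upwards [hfar] with x hx
    have h4 := hGout x hx
    rw [hGl] at h4
    simp only [E] at h4
    rw [h4, sub_sub_cancel, Finset.mul_sum]
    exact Finset.sum_congr rfl fun j _ => by ring
  exact tendsto_nhds_unique h2 hlim

/-! ### Upper bound -/

lemma circ_bound {g : ℂ → ℂ} {c : ℂ} {ρ K a b : ℝ} (hρ : 0 ≤ ρ)
    (hg : ∀ θ, ‖g (circleMap c ρ θ)‖ ≤ K + a * Real.cos θ + b * Real.sin θ) :
    ‖(2 * Real.pi * I : ℂ)⁻¹ * ∮ ζ in C(c, ρ), g ζ‖ ≤ ρ * K := by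
  have h1 : ‖∮ ζ in C(c, ρ), g ζ‖ ≤
      ∫ θ in (0:ℝ)..(2 * Real.pi), ρ * (K + a * Real.cos θ + b * Real.sin θ) := by
    refine intervalIntegral.norm_integral_le_of_norm_le (by positivity) ?_ ?_
    · refine Filter.Eventually.of_forall fun θ _ => ?_
      rw [norm_smul]
      have h3 : ‖deriv (circleMap c ρ) θ‖ = ρ := by
        simp [deriv_circleMap, abs_of_nonneg hρ]
      rw [h3]
      exact mul_le_mul_of_nonneg_left (hg θ) hρ
    · exact Continuous.intervalIntegrable (by fun_prop) _ _
  have h2 : (∫ θ in (0:ℝ)..(2 * Real.pi), ρ * (K + a * Real.cos θ + b * Real.sin θ))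
      = ρ * (K * (2 * Real.pi)) := by
    rw [intervalIntegral.integral_const_mul, intervalIntegral.integral_add,
      intervalIntegral.integral_add, intervalIntegral.integral_const_mul,
      intervalIntegral.integral_const_mul, integral_cos, integral_sin]
    · simp only [intervalIntegral.integral_const, smul_eq_mul, Real.sin_two_pi,
        Real.cos_two_pi, Real.sin_zero, Real.cos_zero]
      ring
    all_goals exact Continuous.intervalIntegrable (by fun_prop) _ _
  rw [norm_mul, norm_inv]
  have h4 : ‖(2 * Real.pi * I : ℂ)‖ = 2 * Real.pi := by
    simp [abs_of_pos Real.pi_pos]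
  rw [h4]
  have hpi := Real.pi_pos
  rw [h2] at h1
  calc (2 * Real.pi)⁻¹ * ‖∮ ζ in C(c, ρ), g ζ‖ ≤ (2 * Real.pi)⁻¹ * (ρ * (K * (2 * Real.pi))) := by
        gcongr
    _ = ρ * K := by field_simp

/-- The sum of the inverses of the differences (the diagonal term is `0⁻¹ = 0`). -/
def sv {ι : Type*} [Fintype ι] (z : ι → ℂ) (j : ι) : ℂ := ∑ k, (z j - z k)⁻¹

/-- The second order coefficient. -/
def Sv {ι : Type*} [Fintype ι] (z : ι → ℂ) : ℝ := ∑ j, ‖sv z j‖ ^ 2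

lemma sum_sv {ι : Type*} [Fintype ι] (z : ι → ℂ) : ∑ j, sv z j = 0 := by
  have h : ∑ j, sv z j = - ∑ j, sv z j := by
    unfold sv
    conv_lhs => rw [Finset.sum_comm]
    rw [← Finset.sum_neg_distrib]
    refine Finset.sum_congr rfl fun j _ => ?_
    rw [← Finset.sum_neg_distrib]
    refine Finset.sum_congr rfl fun k _ => ?_
    rw [← neg_sub, inv_neg]
  linear_combination h / 2

lemma exists_sep {ι : Type*} [Fintype ι] (z : ι → ℂ) (hz : Function.Injective z) :
    ∃ δ > (0:ℝ), δ ≤ 1 ∧ ∀ j k, j ≠ k → 2 * δ ≤ dist (z j) (z k) := by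
  classical
  have : ∀ p : ι × ι, ∃ δ > (0:ℝ), p.1 ≠ p.2 → δ ≤ dist (z p.1) (z p.2) := by
    intro p
    by_cases h : p.1 = p.2
    · exact ⟨1, one_pos, fun h' => absurd h h'⟩
    · exact ⟨_, dist_pos.2 (hz.ne h), fun _ => le_rfl⟩
  choose d hd0 hd using this
  have h1 : ∃ m > (0:ℝ), ∀ p, m ≤ d p := by
    rcases isEmpty_or_nonempty (ι × ι) with h | h
    · exact ⟨1, one_pos, fun p => isEmptyElim p⟩
    · obtain ⟨p, hp⟩ := Finite.exists_min d
      exact ⟨d p, hd0 p, hp⟩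
  obtain ⟨m, hm, hmd⟩ := h1
  refine ⟨min (m/2) 1, by positivity, min_le_right _ _, fun j k hjk => ?_⟩
  have := hmd (j, k)
  have h2 := hd (j, k) hjk
  have h3 := min_le_left (m/2) 1
  simp only at h2
  linarith

lemma norm_sq_expand (ρ P : ℝ) (hρ : 0 ≤ ρ) (hρ1 : ρ ≤ 1) (p β e : ℂ)
    (hp : ‖p‖ ≤ P) (hβ : ‖β‖ ≤ P) (he : ‖e‖ ≤ P) :
    ‖1 + ρ * p + ρ^2 * β + ρ^3 * e‖^2 ≤
      1 + 2 * ρ * p.re + 2 * ρ^2 * β.re + ρ^2 * ‖p‖^2 + (2 * P + 8 * P^2) * ρ^3 := by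
  have hP : 0 ≤ P := (norm_nonneg _).trans hp
  set q : ℂ := β + ρ * e with hq
  have hqn : ‖q‖ ≤ 2 * P := by
    have : ‖(ρ:ℂ) * e‖ ≤ 1 * P := by
      rw [norm_mul, Complex.norm_real, Real.norm_of_nonneg hρ]; gcongr
    calc ‖q‖ ≤ _ := norm_add_le _ _
      _ ≤ 2 * P := by linarith
  have hpq : p.re * q.re + p.im * q.im ≤ 2 * P^2 := by
    have h1 : p.re * q.re + p.im * q.im = (p * (starRingEnd ℂ) q).re := by
      simp
    rw [h1]
    calc _ ≤ ‖p * (starRingEnd ℂ) q‖ := Complex.re_le_norm _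
      _ = ‖p‖ * ‖q‖ := by simp
      _ ≤ P * (2 * P) := by gcongr
      _ = _ := by ring
  have heq : (1 + ρ * p + ρ^2 * β + ρ^3 * e : ℂ) = 1 + ρ * p + ρ^2 * q := by
    rw [hq]; ring
  have hqre : q.re = β.re + ρ * e.re := by simp [hq]
  have hn : ‖1 + ρ * p + ρ^2 * q‖^2 = 1 + 2 * ρ * p.re + 2 * ρ^2 * q.re + ρ^2 * ‖p‖^2
      + 2 * ρ^3 * (p.re * q.re + p.im * q.im) + ρ^4 * ‖q‖^2 := by
    have e1 : (1 + ρ * p + ρ^2 * q : ℂ).re = 1 + ρ * p.re + ρ^2 * q.re := by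
      simp [← Complex.ofReal_pow]
    have e2 : (1 + ρ * p + ρ^2 * q : ℂ).im = ρ * p.im + ρ^2 * q.im := by
      simp [← Complex.ofReal_pow]
    rw [Complex.sq_norm, Complex.sq_norm, Complex.sq_norm, Complex.normSq_apply,
      Complex.normSq_apply, Complex.normSq_apply, e1, e2]
    ring
  rw [heq, hn]
  have h8 : ρ^2 * q.re = ρ^2 * β.re + ρ^3 * e.re := by rw [hqre]; ring
  have h3 : e.re ≤ P := (Complex.re_le_norm e).trans he
  have h4 : ‖q‖^2 ≤ (2 * P)^2 := by gcongr
  have h5 : ρ^4 * ‖q‖^2 ≤ ρ^3 * (2*P)^2 := by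
    have : ρ^4 ≤ ρ^3 := pow_le_pow_of_le_one hρ hρ1 (by norm_num)
    gcongr
  have h6 : ρ^3 * e.re ≤ ρ^3 * P := by gcongr
  have h7 : ρ^3 * (p.re * q.re + p.im * q.im) ≤ ρ^3 * (2 * P^2) := by gcongr
  linarith

lemma inv_first_order {x a b : ℂ} {δ ρ : ℝ} (hδ : 0 < δ) (hab : 2 * δ ≤ dist a b)
    (hx : dist x a = ρ) (hρ : ρ ≤ δ) :
    ‖(x - b)⁻¹ - (a - b)⁻¹‖ ≤ ρ / δ^2 := by
  have h1 : 2 * δ ≤ ‖a - b‖ := by rwa [dist_eq_norm] at hab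
  have h2 : ‖x - a‖ = ρ := by rwa [dist_eq_norm] at hx
  have h3 : δ ≤ ‖x - b‖ := by
    have : ‖a - b‖ ≤ ‖x - b‖ + ‖x - a‖ := by
      calc ‖a - b‖ = ‖(x - b) - (x - a)‖ := by ring_nf
        _ ≤ _ := norm_sub_le _ _
    linarith
  have hab0 : a - b ≠ 0 := norm_pos_iff.1 (by linarith)
  have hxb0 : x - b ≠ 0 := norm_pos_iff.1 (by linarith)
  have : (x - b)⁻¹ - (a - b)⁻¹ = -(x - a) / ((x - b) * (a - b)) := by
    field_simp
    ring
  rw [this, norm_div, norm_neg, h2, norm_mul]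
  have h4 : δ^2 ≤ ‖x - b‖ * ‖a - b‖ := by
    rw [sq]; exact mul_le_mul h3 (by linarith) hδ.le (norm_nonneg _)
  have : 0 ≤ ρ := by rw [← h2]; exact norm_nonneg _
  gcongr

lemma tendsto_inv_sub (a : ℂ) : Tendsto (fun x : ℂ => (x - a)⁻¹) (cobounded ℂ) (𝓝 0) := by
  have : Tendsto (fun x : ℂ => x - a) (cobounded ℂ) (cobounded ℂ) := by
    simp [sub_eq_add_neg]
  exact tendsto_inv₀_cobounded.comp this

lemma tendsto_mul_inv_sub (a : ℂ) :
    Tendsto (fun x : ℂ => x * (x - a)⁻¹) (cobounded ℂ) (𝓝 1) := by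
  have h := ((tendsto_inv_sub a).const_mul a).const_add 1
  rw [mul_zero, add_zero] at h
  refine h.congr' ?_
  have : ({a} : Set ℂ)ᶜ ∈ cobounded ℂ := by
    rw [← Bornology.isBounded_def]; exact isBounded_singleton
  filter_upwards [this] with x hx
  have : x - a ≠ 0 := sub_ne_zero.2 hx
  field_simp
  ring

lemma cobounded_inf_compl {ι : Type*} [Fintype ι] (z : ι → ℂ) (r : ℝ) :
    cobounded ℂ ⊓ 𝓟 (⋃ j, closedBall (z j) r)ᶜ = cobounded ℂ := by
  rw [inf_eq_left, le_principal_iff, ← Bornology.isBounded_def, isBounded_iUnion]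
  exact fun j => isBounded_closedBall

lemma upper_bound {ι : Type*} [Fintype ι] (z : ι → ℂ) (hz : Function.Injective z) :
    ∃ M > (0:ℝ), ∃ r₀ > (0:ℝ), ∀ r ρ : ℝ, 0 < r → r < ρ → ρ < r₀ → ∀ (f : ℂ → ℂ) (l w : ℂ),
      DifferentiableOn ℂ f (⋃ j, closedBall (z j) r)ᶜ →
      (∀ x ∈ (⋃ j, closedBall (z j) r)ᶜ, ‖f x‖ ≤ 1) →
      HasDerivAtInftyOn f (⋃ j, closedBall (z j) r)ᶜ l w →
      ‖w‖ ≤ Fintype.card ι * ρ - Sv z * ρ^3 + M * ρ^4 := by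
  classical
  obtain ⟨δ, hδ, hδ1, hsep⟩ := exists_sep z hz
  set b : ι → ℂ := fun k => (starRingEnd ℂ) (sv z k) with hb
  have hbn : ∀ k, ‖b k‖ = ‖sv z k‖ := fun k => by simp [hb]
  set β : ι → ℂ := fun j => ∑ k, b k * (z j - z k)⁻¹ with hβ
  set P : ℝ := ∑ k, ‖b k‖ + ∑ j, ‖β j‖ + ∑ k, ‖b k‖ / δ^2 with hP
  have hs1 : 0 ≤ ∑ k, ‖b k‖ := Finset.sum_nonneg fun k _ => norm_nonneg _
  have hs2 : 0 ≤ ∑ k, ‖β k‖ := Finset.sum_nonneg fun k _ => norm_nonneg _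
  have hs3 : 0 ≤ ∑ k, ‖b k‖ / δ^2 := Finset.sum_nonneg fun k _ => by positivity
  have hP0 : 0 ≤ P := by linarith
  have hPb : ∀ j, ‖b j‖ ≤ P := fun j => by
    have := Finset.single_le_sum (f := fun k => ‖b k‖) (fun k _ => norm_nonneg _)
      (Finset.mem_univ j)
    linarith
  have hPβ : ∀ j, ‖β j‖ ≤ P := fun j => by
    have := Finset.single_le_sum (f := fun k => ‖β k‖) (fun k _ => norm_nonneg _)
      (Finset.mem_univ j)
    linarith
  have hbsum : ∑ k, b k = 0 := by
    rw [hb, ← map_sum, sum_sv, map_zero]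
  have hβsum : ∑ j, (β j).re = - Sv z := by
    rw [← Complex.re_sum, hβ, Finset.sum_comm]
    have : ∀ k, ∑ j, b k * (z j - z k)⁻¹ = - ((‖sv z k‖^2 : ℝ) : ℂ) := by
      intro k
      rw [← Finset.mul_sum]
      have : ∑ j, (z j - z k)⁻¹ = - sv z k := by
        rw [sv, ← Finset.sum_neg_distrib]
        exact Finset.sum_congr rfl fun j _ => by rw [← neg_sub, inv_neg]
      rw [this, mul_neg, hb]
      simp only
      rw [← Complex.normSq_eq_conj_mul_self, Complex.normSq_eq_norm_sq]
    simp only [this]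
    rw [Finset.sum_neg_distrib, ← Complex.ofReal_sum, Complex.neg_re, Complex.ofReal_re]
    rfl
  refine ⟨Fintype.card ι * (2 * P + 8 * P^2) + 1, by positivity, δ, hδ, ?_⟩
  intro r ρ hr hrρ hρδ f l w hfd hfb hfl
  have hρ : 0 < ρ := hr.trans hrρ
  rw [HasDerivAtInftyOn, cobounded_inf_compl] at hfl
  obtain ⟨hl, hw⟩ := hfl
  set h : ℂ → ℂ := fun x => 1 + ∑ k, ρ^2 * b k * (x - z k)⁻¹ with hh
  -- behaviour at infinity
  have hh1 : Tendsto h (cobounded ℂ) (𝓝 1) := by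
    have := (tendsto_finsetSum (Finset.univ) fun k _ =>
      (tendsto_inv_sub (z k)).const_mul ((ρ:ℂ)^2 * b k)).const_add 1
    simpa using this
  have hh2 : Tendsto (fun x => x * (h x - 1)) (cobounded ℂ) (𝓝 0) := by
    have := (tendsto_finsetSum (Finset.univ) fun k _ =>
      (tendsto_mul_inv_sub (z k)).const_mul ((ρ:ℂ)^2 * b k))
    have h0 : ∑ k, (ρ:ℂ)^2 * b k * 1 = 0 := by
      simp only [mul_one]; rw [← Finset.mul_sum, hbsum, mul_zero]
    rw [h0] at this
    refine this.congr fun x => ?_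
    simp only [hh, add_sub_cancel_left, Finset.mul_sum]
    exact Finset.sum_congr rfl fun k _ => by ring
  have hF1 : Tendsto (fun x => f x * h x ^ 2) (cobounded ℂ) (𝓝 l) := by
    simpa using hl.mul (hh1.pow 2)
  have hF2 : Tendsto (fun x => x * (f x * h x ^ 2 - l)) (cobounded ℂ) (𝓝 w) := by
    have h3 := (hw.mul (hh1.pow 2)).add ((hh2.mul (hh1.add_const 1)).const_mul l)
    have h4 : w * 1^2 + l * (0 * (1 + 1)) = w := by ring
    rw [h4] at h3
    refine h3.congr fun x => by ring
  have hFd : DifferentiableOn ℂ (fun x => f x * h x ^ 2) (⋃ j, closedBall (z j) r)ᶜ := by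
    refine hfd.mul (DifferentiableOn.pow ?_ 2)
    refine DifferentiableOn.const_add _ ?_
    refine DifferentiableOn.fun_sum fun k _ => ?_
    intro x hx
    have hxk : x - z k ≠ 0 := by
      intro h0
      rw [sub_eq_zero] at h0
      apply hx
      rw [mem_iUnion]
      exact ⟨k, by rw [h0]; exact mem_closedBall_self hr.le⟩
    exact DifferentiableAt.differentiableWithinAt (by fun_prop (disch := assumption))
  rw [cauchy_residue z hr hrρ hρδ hsep _ hFd l w hF1 hF2]
  have hcirc : ∀ j, ‖(2 * Real.pi * I : ℂ)⁻¹ * ∮ ζ in C(z j, ρ), f ζ * h ζ ^ 2‖ ≤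
      ρ * (1 + 2 * ρ^2 * (β j).re + ρ^2 * ‖b j‖^2 + (2 * P + 8 * P^2) * ρ^3) := by
    intro j
    refine circ_bound (a := 2 * ρ * (b j).re) (b := 2 * ρ * (b j).im) hρ.le fun θ => ?_
    set x := circleMap (z j) ρ θ with hx
    have hxs : dist x (z j) = ρ := circleMap_mem_sphere _ hρ.le θ
    have hxf : ‖f x‖ ≤ 1 := by
      apply hfb
      simp only [mem_compl_iff, mem_iUnion, not_exists, mem_closedBall, not_le]
      intro k
      by_cases hjk : j = k
      · subst hjk; linarith
      · have h1 := hsep j k hjk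
        have h2 := dist_triangle_left (z j) (z k) x
        linarith
    rw [norm_mul, norm_pow]
    set p : ℂ := b j * Complex.exp (-(θ * I)) with hp
    have hpn : ‖p‖ = ‖b j‖ := by
      rw [hp, norm_mul]
      have : ‖Complex.exp (-(θ * I))‖ = 1 := by
        rw [Complex.norm_exp]; simp
      rw [this, mul_one]
    have hpre : p.re = (b j).re * Real.cos θ + (b j).im * Real.sin θ := by
      have : Complex.exp (-(θ * I)) = Real.cos θ - Real.sin θ * I := by
        rw [← neg_mul, Complex.exp_mul_I, Complex.cos_neg, Complex.sin_neg]
        push_cast; ring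
      rw [hp, this]
      simp [Complex.cos_ofReal_re, Complex.sin_ofReal_re, Complex.cos_ofReal_im,
        Complex.sin_ofReal_im]
    set e : ℂ := ∑ k ∈ Finset.univ.erase j, b k * (((x - z k)⁻¹ - (z j - z k)⁻¹) / ρ) with he
    have hρc : (ρ:ℂ) ≠ 0 := by exact_mod_cast hρ.ne'
    have hen : ‖e‖ ≤ P := by
      calc ‖e‖ ≤ ∑ k ∈ Finset.univ.erase j, ‖b k‖ / δ^2 := by
            refine norm_sum_le_of_le _ fun k hk => ?_
            have h1 := inv_first_order hδ (hsep j k (Finset.ne_of_mem_erase hk).symm) hxs hρδ.le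
            rw [norm_mul, norm_div, Complex.norm_real, Real.norm_of_nonneg hρ.le]
            calc _ ≤ ‖b k‖ * ((ρ / δ^2) / ρ) := by gcongr
              _ = _ := by field_simp
        _ ≤ ∑ k, ‖b k‖ / δ^2 := Finset.sum_le_sum_of_subset_of_nonneg (Finset.subset_univ _)
            fun k _ _ => by positivity
        _ ≤ P := by linarith
    have hhx : h x = 1 + ρ * p + ρ^2 * β j + ρ^3 * e := by
      have h1 : β j = ∑ k ∈ Finset.univ.erase j, b k * (z j - z k)⁻¹ := by
        rw [hβ]
        simp only
        rw [← Finset.add_sum_erase _ _ (Finset.mem_univ j)]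
        simp
      have h2 : (x - z j)⁻¹ = (ρ:ℂ)⁻¹ * Complex.exp (-(θ * I)) := by
        rw [hx, circleMap, add_sub_cancel_left, mul_inv, Complex.exp_neg]
      rw [hh]
      simp only
      rw [← Finset.add_sum_erase _ _ (Finset.mem_univ j), h1, he, h2, Finset.mul_sum,
        Finset.mul_sum, add_assoc, add_assoc, ← Finset.sum_add_distrib]
      congr 2
      · rw [hp]; field_simp
      · refine Finset.sum_congr rfl fun k _ => ?_
        generalize (x - z k)⁻¹ = u
        generalize (z j - z k)⁻¹ = v
        field_simp
        ring
    have hmain := norm_sq_expand ρ P hρ.le (by linarith) p (β j) e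
      (by rw [hpn]; exact hPb j) (hPβ j) hen
    rw [← hhx, hpn, hpre] at hmain
    have h5 : ‖f x‖ * ‖h x‖^2 ≤ 1 * ‖h x‖^2 := by gcongr
    rw [one_mul] at h5
    refine h5.trans (hmain.trans (le_of_eq ?_))
    ring
  refine (norm_sum_le_of_le _ fun j _ => hcirc j).trans ?_
  rw [← Finset.mul_sum, Finset.sum_add_distrib, Finset.sum_add_distrib, Finset.sum_add_distrib,
    ← Finset.mul_sum, ← Finset.mul_sum, hβsum]
  simp only [hbn, Finset.sum_const, Finset.card_univ, nsmul_eq_mul]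
  have : ∑ k, ‖sv z k‖^2 = Sv z := rfl
  rw [this]
  have h4 : 0 ≤ ρ^4 := by positivity
  nlinarith

/-! ### Lower bound -/

lemma max_ext {ι : Type*} [Fintype ι] (z : ι → ℂ) {r C : ℝ} (f : ℂ → ℂ) (hC : 0 < C)
    (hf : ∀ x, (∀ j, r ≤ dist x (z j)) → DifferentiableAt ℂ f x)
    (hs : ∀ j, ∀ x, dist x (z j) = r → ‖f x‖ ≤ C)
    (hlim : Tendsto f (cobounded ℂ) (𝓝 0)) :
    ∀ x ∈ (⋃ j, closedBall (z j) r)ᶜ, ‖f x‖ ≤ C := by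
  intro x hx
  have hev : ∀ᶠ y in cobounded ℂ, ‖f y‖ < C := by
    have := hlim.norm
    rw [norm_zero] at this
    exact this.eventually_lt_const hC
  obtain ⟨T, -, hT⟩ := (hasBasis_cobounded_norm (E := ℂ)).eventually_iff.1 hev
  set T' := max T (‖x‖ + 1) with hT'
  set U : Set ℂ := (⋃ j, closedBall (z j) r)ᶜ ∩ ball 0 T' with hU
  have hop : IsOpen U :=
    (isClosed_iUnion_of_finite fun j => isClosed_closedBall).isOpen_compl.inter isOpen_ball
  have hxU : x ∈ U := by
    refine ⟨hx, ?_⟩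
    rw [mem_ball_zero_iff]
    have := le_max_right T (‖x‖ + 1)
    linarith
  have hcl : ∀ y ∈ closure U, ∀ j, r ≤ dist y (z j) := by
    intro y hy j
    have hc : IsClosed {y | r ≤ dist y (z j)} :=
      isClosed_le continuous_const (continuous_id.dist continuous_const)
    refine closure_minimal (fun y hy => ?_) hc hy
    by_contra h
    simp only [mem_ofPred_eq, not_le] at h
    exact hy.1 (mem_iUnion.2 ⟨j, h.le⟩)
  refine Complex.norm_le_of_forall_mem_frontier_norm_le (U := U)
    (isBounded_ball.subset inter_subset_right)
    (DifferentiableOn.diffContOnCl fun y hy => (hf y (hcl y hy)).differentiableWithinAt) ?_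
    (subset_closure hxU)
  intro y hy
  rw [hop.frontier_eq] at hy
  by_cases hyK : y ∈ ⋃ j, closedBall (z j) r
  · obtain ⟨j, hj⟩ := mem_iUnion.1 hyK
    exact hs j y (le_antisymm hj (hcl y hy.1 j))
  · have : y ∉ ball 0 T' := fun h => hy.2 ⟨hyK, h⟩
    rw [mem_ball_zero_iff, not_lt] at this
    exact (hT ((le_max_left _ _).trans this)).le

lemma inv_second_order {ζ a b : ℂ} {r : ℝ} (hab : a - b ≠ 0) (hx : a + r * ζ - b ≠ 0) :
    (a + r * ζ - b)⁻¹ = (a - b)⁻¹ - r * ζ * (a - b)⁻¹^2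
      + r^2 * ζ^2 * (a - b)⁻¹^2 * (a + r * ζ - b)⁻¹ := by
  have h : a + r * ζ - b = (a - b) + r * ζ := by ring
  rw [h] at hx ⊢
  generalize a - b = d at *
  field_simp
  ring

/-- The sum of inverse squares of the differences. -/
def qv {ι : Type*} [Fintype ι] (z : ι → ℂ) (j : ι) : ℂ := ∑ k, (z j - z k)⁻¹ ^ 2

/-- The building block of the near-extremal function. -/
def psi (r : ℝ) (s q u : ℂ) : ℂ :=
  (1 - r^2 * (‖s‖^2 : ℝ)) * u - r * (starRingEnd ℂ) s * u^2
    + r^2 * ((starRingEnd ℂ) s ^ 2 + (starRingEnd ℂ) q) * u^3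

/-- Error term in the expansion of `psi`. -/
def errE (r : ℝ) (s q ζ d v : ℂ) : ℂ :=
  ζ^2 * d^2 * v + (-(‖s‖^2 : ℝ) * v - (starRingEnd ℂ) s * v^2
    + r^2 * ((starRingEnd ℂ) s ^ 2 + (starRingEnd ℂ) q) * v^3)

lemma psi_expand (r : ℝ) (s q ζ d v : ℂ) (hv : v = d - r * ζ * d^2 + r^2 * ζ^2 * d^2 * v) :
    psi r s q (r * v) = r * d - r^2 * ζ * d^2 + r^3 * errE r s q ζ d v := by
  unfold psi errE
  linear_combination (r:ℂ) * hv

lemma errE_bound {r Λ : ℝ} (hr : 0 ≤ r) (hr1 : r ≤ 1) {s q ζ d v : ℂ} (hζ : ‖ζ‖ = 1)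
    (hd : ‖d‖ ≤ Λ) (hv : ‖v‖ ≤ Λ) :
    ‖errE r s q ζ d v‖ ≤ Λ^3 + (‖s‖^2 * Λ + ‖s‖ * Λ^2 + (‖s‖^2 + ‖q‖) * Λ^3) := by
  have hΛ : 0 ≤ Λ := (norm_nonneg _).trans hd
  unfold errE
  have h1 : ‖ζ^2 * d^2 * v‖ ≤ Λ^3 := by
    rw [norm_mul, norm_mul, norm_pow, norm_pow, hζ, one_pow, one_mul]
    calc _ ≤ Λ^2 * Λ := by gcongr
      _ = _ := by ring
  have h2 : ‖-((‖s‖^2 : ℝ) : ℂ) * v‖ ≤ ‖s‖^2 * Λ := by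
    rw [norm_mul, norm_neg, Complex.norm_real, Real.norm_of_nonneg (by positivity)]
    gcongr
  have h3 : ‖(starRingEnd ℂ) s * v^2‖ ≤ ‖s‖ * Λ^2 := by
    rw [norm_mul, norm_pow, RCLike.norm_conj]
    gcongr
  have h4 : ‖(r:ℂ)^2 * ((starRingEnd ℂ) s ^ 2 + (starRingEnd ℂ) q) * v^3‖ ≤
      (‖s‖^2 + ‖q‖) * Λ^3 := by
    have h5 : ‖(starRingEnd ℂ) s ^ 2 + (starRingEnd ℂ) q‖ ≤ ‖s‖^2 + ‖q‖ := by
      refine (norm_add_le _ _).trans ?_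
      rw [norm_pow, RCLike.norm_conj, RCLike.norm_conj]
    rw [norm_mul, norm_mul, norm_pow, norm_pow, Complex.norm_real, Real.norm_of_nonneg hr]
    have : r^2 ≤ 1 := pow_le_one₀ hr hr1
    calc _ ≤ 1 * (‖s‖^2 + ‖q‖) * Λ^3 := by gcongr
      _ = _ := by ring
  refine (norm_add_le _ _).trans (add_le_add h1 ((norm_add_le _ _).trans (add_le_add
    ((norm_sub_le _ _).trans (add_le_add h2 h3)) h4)))

lemma circle_estimate {r P : ℝ} (hr : 0 ≤ r) (hr1 : r ≤ 1) {s q ζ E : ℂ} (hζ : ‖ζ‖ = 1)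
    (hP : 2 * ‖s‖ + 2 * ‖s‖^2 + 2 * ‖q‖ + ‖E‖ ≤ P) :
    ‖psi r s q (ζ⁻¹) + r * s - r^2 * ζ * q + r^3 * E‖ ≤ 1 + (2 * P + 8 * P^2) * r^3 := by
  have hζ0 : ζ ≠ 0 := norm_pos_iff.1 (by rw [hζ]; norm_num)
  have hconj : (starRingEnd ℂ) ζ = ζ⁻¹ := by
    rw [Complex.inv_def, Complex.normSq_eq_norm_sq, hζ]; simp
  set a : ℂ := s * ζ with ha
  set t : ℂ := q * ζ^2 with ht
  have han : ‖a‖ = ‖s‖ := by rw [ha, norm_mul, hζ, mul_one]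
  have htn : ‖t‖ = ‖q‖ := by rw [ht, norm_mul, norm_pow, hζ, one_pow, mul_one]
  set p : ℂ := a - (starRingEnd ℂ) a with hp
  set β : ℂ := -(‖s‖^2 : ℝ) + (starRingEnd ℂ) a ^ 2 + ((starRingEnd ℂ) t - t) with hβ
  have heq : ζ * (psi r s q (ζ⁻¹) + r * s - r^2 * ζ * q + r^3 * E) =
      1 + r * p + r^2 * β + r^3 * (ζ * E) := by
    unfold psi
    rw [hp, hβ, ha, ht]
    simp only [map_mul, map_pow, hconj]
    field_simp
    ring
  have hnorm : ‖psi r s q (ζ⁻¹) + r * s - r^2 * ζ * q + r^3 * E‖ =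
      ‖1 + r * p + r^2 * β + r^3 * (ζ * E)‖ := by
    rw [← heq, norm_mul, hζ, one_mul]
  have n1 := norm_nonneg s
  have n2 := norm_nonneg q
  have n3 := norm_nonneg E
  have n4 := sq_nonneg ‖s‖
  have hpn : ‖p‖ ≤ 2 * ‖s‖ := by
    refine (norm_sub_le _ _).trans ?_
    rw [RCLike.norm_conj, han]; linarith
  have hβn : ‖β‖ ≤ 2 * ‖s‖^2 + 2 * ‖q‖ := by
    have h1 : ‖-((‖s‖^2 : ℝ) : ℂ)‖ = ‖s‖^2 := by
      rw [norm_neg, Complex.norm_real, Real.norm_of_nonneg (by positivity)]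
    have h2 : ‖(starRingEnd ℂ) a ^ 2‖ = ‖s‖^2 := by rw [norm_pow, RCLike.norm_conj, han]
    have h3 : ‖(starRingEnd ℂ) t - t‖ ≤ 2 * ‖q‖ := by
      refine (norm_sub_le _ _).trans ?_
      rw [RCLike.norm_conj, htn]; linarith
    have h4 := norm_add_le (-((‖s‖^2 : ℝ) : ℂ)) ((starRingEnd ℂ) a ^ 2)
    have h5 := norm_add_le (-((‖s‖^2 : ℝ) : ℂ) + (starRingEnd ℂ) a ^ 2) ((starRingEnd ℂ) t - t)
    rw [hβ]
    linarith
  have hEn : ‖ζ * E‖ ≤ P := by rw [norm_mul, hζ, one_mul]; linarith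
  have hmain := norm_sq_expand r P hr hr1 p β (ζ * E) (by linarith) (by linarith) hEn
  rw [← hnorm] at hmain
  have hpre : p.re = 0 := by simp [hp]
  have hpsq : ‖p‖^2 = 4 * a.im^2 := by
    rw [Complex.sq_norm, Complex.normSq_apply]
    simp [hp]
    ring
  have hβre : β.re = - 2 * a.im^2 := by
    have h1 : ‖s‖^2 = a.re^2 + a.im^2 := by
      rw [← han, Complex.sq_norm, Complex.normSq_apply]; ring
    rw [hβ, h1]
    simp [sq]
    ring
  rw [hpre, hpsq, hβre] at hmain
  have hP0 : 0 ≤ P := by linarith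
  have hnn : 0 ≤ (2 * P + 8 * P^2) * r^3 := by positivity
  refine (le_abs_self _).trans (abs_le_of_sq_le_sq ?_ (by linarith))
  nlinarith

lemma lower_bound {ι : Type*} [Fintype ι] (z : ι → ℂ) (hz : Function.Injective z) :
    ∃ M > (0:ℝ), ∃ r₀ > (0:ℝ), ∀ r : ℝ, 0 < r → r < r₀ → ∃ (f : ℂ → ℂ) (l w : ℂ),
      DifferentiableOn ℂ f (⋃ j, closedBall (z j) r)ᶜ ∧
      (∀ x ∈ (⋃ j, closedBall (z j) r)ᶜ, ‖f x‖ ≤ 1) ∧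
      HasDerivAtInftyOn f (⋃ j, closedBall (z j) r)ᶜ l w ∧
      Fintype.card ι * r - Sv z * r^3 - M * r^4 ≤ ‖w‖ := by
  classical
  obtain ⟨δ, hδ, hδ1, hsep⟩ := exists_sep z hz
  set s : ι → ℂ := sv z with hs
  set q : ι → ℂ := qv z with hq
  set Λ : ℝ := δ⁻¹ with hΛ
  have hΛ0 : 0 < Λ := inv_pos.2 hδ
  set B : ι → ℝ := fun k => Λ^3 + (‖s k‖^2 * Λ + ‖s k‖ * Λ^2 + (‖s k‖^2 + ‖q k‖) * Λ^3) with hB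
  have hB0 : ∀ k, 0 ≤ B k := fun k => by simp only [hB]; positivity
  set Q : ι → ℝ := fun j => 2 * ‖s j‖ + 2 * ‖s j‖^2 + 2 * ‖q j‖ with hQ
  have hQ0 : ∀ k, 0 ≤ Q k := fun k => by simp only [hQ]; positivity
  set P : ℝ := ∑ j, Q j + ∑ k, B k with hP
  have hP0 : 0 ≤ P := add_nonneg (Finset.sum_nonneg fun k _ => hQ0 k)
    (Finset.sum_nonneg fun k _ => hB0 k)
  set N : ℝ := 2 * P + 8 * P^2 with hN
  have hN0 : 0 ≤ N := by positivity
  refine ⟨Fintype.card ι * N + 1, by positivity, δ, hδ, ?_⟩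
  intro r hr hrδ
  have hr1 : r ≤ 1 := by linarith
  set f : ℂ → ℂ := fun x => ∑ j, psi r (s j) (q j) (r * (x - z j)⁻¹) with hf
  have hfd : ∀ x, (∀ j, r ≤ dist x (z j)) → DifferentiableAt ℂ f x := by
    intro x hx
    refine DifferentiableAt.fun_sum fun k _ => ?_
    have hxk : x - z k ≠ 0 := by
      intro h0
      have := hx k
      rw [dist_eq_norm, h0, norm_zero] at this
      linarith
    unfold psi
    fun_prop (disch := assumption)
  have hpsi1 : ∀ j, Tendsto (fun x => psi r (s j) (q j) (r * (x - z j)⁻¹)) (cobounded ℂ)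
      (𝓝 0) := by
    intro j
    have h1 := (tendsto_inv_sub (z j)).const_mul (r:ℂ)
    have hc : Continuous (psi r (s j) (q j)) := by unfold psi; fun_prop
    have h2 := (hc.tendsto (r * 0)).comp h1
    have h3 : psi r (s j) (q j) (r * 0) = 0 := by simp [psi]
    rw [h3] at h2
    exact h2
  have hf0 : Tendsto f (cobounded ℂ) (𝓝 0) := by
    have := tendsto_finsetSum (Finset.univ) fun j _ => hpsi1 j
    simpa using this
  set A : ℝ := Fintype.card ι * r - Sv z * r^3 with hA
  have hpsi2 : ∀ j, Tendsto (fun x => x * psi r (s j) (q j) (r * (x - z j)⁻¹)) (cobounded ℂ)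
      (𝓝 ((r - r^3 * ‖s j‖^2 : ℝ) : ℂ)) := by
    intro j
    have h1 := tendsto_mul_inv_sub (z j)
    have h0 := tendsto_inv_sub (z j)
    have h2 := ((h1.const_mul ((1 - r^2 * (‖s j‖^2 : ℝ)) * r : ℂ)).sub
      ((h1.mul h0).const_mul (r * (starRingEnd ℂ) (s j) * r^2 : ℂ))).add
      ((h1.mul (h0.mul h0)).const_mul
        (r^2 * ((starRingEnd ℂ) (s j) ^ 2 + (starRingEnd ℂ) (q j)) * r^3 : ℂ))
    have h3 : ((1 - r^2 * (‖s j‖^2 : ℝ)) * r : ℂ) * 1 -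
      (r * (starRingEnd ℂ) (s j) * r^2 : ℂ) * (1 * 0) +
      (r^2 * ((starRingEnd ℂ) (s j) ^ 2 + (starRingEnd ℂ) (q j)) * r^3 : ℂ) * (1 * (0 * 0)) =
      ((r - r^3 * ‖s j‖^2 : ℝ) : ℂ) := by
      push_cast; ring
    rw [h3] at h2
    refine h2.congr fun x => ?_
    unfold psi
    ring
  have hfA : Tendsto (fun x => x * f x) (cobounded ℂ) (𝓝 (A : ℂ)) := by
    have h1 := tendsto_finsetSum (Finset.univ) fun j _ => hpsi2 j
    have h2 : ∑ j, ((r - r^3 * ‖s j‖^2 : ℝ) : ℂ) = A := by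
      rw [← Complex.ofReal_sum, Finset.sum_sub_distrib, ← Finset.mul_sum, hA]
      simp only [Finset.sum_const, Finset.card_univ, nsmul_eq_mul, Sv, hs]
      congr 1
      ring
    rw [h2] at h1
    refine h1.congr fun x => ?_
    rw [hf, Finset.mul_sum]
  have hsph : ∀ j, ∀ x, dist x (z j) = r → ‖f x‖ ≤ 1 + N * r^3 := by
    intro j x hx
    have hrc : (r:ℂ) ≠ 0 := by exact_mod_cast hr.ne'
    set ζ : ℂ := (x - z j) / r with hζ
    have hxζ : x = z j + r * ζ := by rw [hζ]; field_simp; ring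
    have hζn : ‖ζ‖ = 1 := by
      rw [hζ, norm_div, ← dist_eq_norm, hx, Complex.norm_real, Real.norm_of_nonneg hr.le]
      exact div_self hr.ne'
    have hk : ∀ k ∈ Finset.univ.erase j, ‖(z j - z k)⁻¹‖ ≤ Λ ∧ ‖(x - z k)⁻¹‖ ≤ Λ ∧
        z j - z k ≠ 0 ∧ x - z k ≠ 0 := by
      intro k hk
      have h1 := hsep j k (Finset.ne_of_mem_erase hk).symm
      have h2 := dist_triangle_left (z j) (z k) x
      have h3 : δ ≤ ‖z j - z k‖ := by rw [← dist_eq_norm]; linarith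
      have h4 : δ ≤ ‖x - z k‖ := by rw [← dist_eq_norm]; linarith
      refine ⟨?_, ?_, norm_pos_iff.1 (by linarith), norm_pos_iff.1 (by linarith)⟩
      · rw [norm_inv]; exact inv_anti₀ hδ h3
      · rw [norm_inv]; exact inv_anti₀ hδ h4
    set E : ℂ := ∑ k ∈ Finset.univ.erase j,
      errE r (s k) (q k) ζ (z j - z k)⁻¹ (x - z k)⁻¹ with hE
    have hEn : ‖E‖ ≤ ∑ k, B k := by
      calc ‖E‖ ≤ ∑ k ∈ Finset.univ.erase j, B k := by
            refine norm_sum_le_of_le _ fun k hk' => ?_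
            obtain ⟨h1, h2, -, -⟩ := hk k hk'
            exact errE_bound hr.le hr1 hζn h1 h2
        _ ≤ _ := Finset.sum_le_sum_of_subset_of_nonneg (Finset.subset_univ _)
            fun k _ _ => hB0 k
    have hfx : f x = psi r (s j) (q j) (ζ⁻¹) + r * s j - r^2 * ζ * q j + r^3 * E := by
      have e1 : s j = ∑ k ∈ Finset.univ.erase j, (z j - z k)⁻¹ := by
        rw [hs, sv, ← Finset.add_sum_erase _ _ (Finset.mem_univ j)]; simp
      have e2 : q j = ∑ k ∈ Finset.univ.erase j, (z j - z k)⁻¹^2 := by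
        rw [hq, qv, ← Finset.add_sum_erase _ _ (Finset.mem_univ j)]; simp
      have e3 : ∀ k ∈ Finset.univ.erase j, psi r (s k) (q k) (r * (x - z k)⁻¹) =
          r * (z j - z k)⁻¹ - r^2 * ζ * (z j - z k)⁻¹^2 +
          r^3 * errE r (s k) (q k) ζ (z j - z k)⁻¹ (x - z k)⁻¹ := by
        intro k hk'
        obtain ⟨-, -, h3, h4⟩ := hk k hk'
        apply psi_expand
        rw [hxζ] at h4 ⊢
        exact inv_second_order h3 h4
      have e4 : (r:ℂ) * (x - z j)⁻¹ = ζ⁻¹ := by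
        rw [hζ, inv_div, div_eq_mul_inv]
      have e5 : f x = psi r (s j) (q j) (ζ⁻¹) +
          (r * ∑ k ∈ Finset.univ.erase j, (z j - z k)⁻¹
          - r^2 * ζ * ∑ k ∈ Finset.univ.erase j, (z j - z k)⁻¹^2 + r^3 * E) := by
        simp only [hf]
        rw [← Finset.add_sum_erase _ _ (Finset.mem_univ j), e4, Finset.sum_congr rfl e3,
          Finset.sum_add_distrib, Finset.sum_sub_distrib, ← Finset.mul_sum, ← Finset.mul_sum,
          ← Finset.mul_sum]
      rw [← e1, ← e2] at e5
      rw [e5]; ring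
    rw [hfx]
    refine circle_estimate hr.le hr1 hζn ?_
    have h6 := Finset.single_le_sum (f := Q) (fun k _ => hQ0 k) (Finset.mem_univ j)
    simp only [hP]
    have h7 : Q j = 2 * ‖s j‖ + 2 * ‖s j‖^2 + 2 * ‖q j‖ := rfl
    linarith
  set C : ℝ := 1 + N * r^3 with hC
  have hC1 : 1 ≤ C := by
    have : 0 ≤ N * r^3 := by positivity
    linarith
  have hC0 : 0 < C := by linarith
  have hmax := max_ext z f hC0 hfd hsph hf0
  refine ⟨fun x => (C:ℂ)⁻¹ * f x, 0, (C:ℂ)⁻¹ * A, ?_, ?_, ?_, ?_⟩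
  · intro x hx
    refine ((hfd x fun j => ?_).const_mul _).differentiableWithinAt
    by_contra! h
    exact hx (mem_iUnion.2 ⟨j, h.le⟩)
  · intro x hx
    rw [norm_mul, norm_inv, Complex.norm_real, Real.norm_of_nonneg hC0.le]
    have := hmax x hx
    rw [inv_mul_le_iff₀ hC0]
    linarith
  · rw [HasDerivAtInftyOn, cobounded_inf_compl]
    constructor
    · have h9 := hf0.const_mul (C:ℂ)⁻¹
      rw [mul_zero] at h9
      exact h9
    · refine (hfA.const_mul (C:ℂ)⁻¹).congr fun x => ?_
      rw [sub_zero]; ring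
  · rw [norm_mul, norm_inv, Complex.norm_real, Complex.norm_real, Real.norm_of_nonneg hC0.le]
    have h1 : C⁻¹ * A ≤ C⁻¹ * ‖A‖ := by
      gcongr
      exact Real.le_norm_self A
    refine le_trans ?_ h1
    have hS0 : 0 ≤ Sv z := Finset.sum_nonneg fun k _ => by positivity
    have hAn : A ≤ Fintype.card ι * r := by
      have : 0 ≤ Sv z * r^3 := by positivity
      linarith
    have hn0 : 0 ≤ (Fintype.card ι : ℝ) * r := by positivity
    rw [inv_mul_eq_div, le_div_iff₀ hC0]
    have h3 : A - (Fintype.card ι * N + 1) * r^4 ≤ A - Fintype.card ι * r * (N * r^3) := by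
      nlinarith [pow_pos hr 4]
    have h4 : 0 ≤ N * r^3 := by positivity
    have h5 : (A - Fintype.card ι * r * (N * r^3)) * C ≤ A := by
      rw [hC]
      generalize N * r^3 = y at *
      generalize (Fintype.card ι : ℝ) * r = m at *
      nlinarith [mul_nonneg hn0 (mul_nonneg h4 h4), mul_nonneg h4 (sub_nonneg.2 hAn)]
    calc _ ≤ (A - Fintype.card ι * r * (N * r^3)) * C := mul_le_mul_of_nonneg_right h3 hC0.le
      _ ≤ A := h5

/-! ### Asymptotics of the capacity -/

lemma capacity_asymp {ι : Type*} [Fintype ι] (z : ι → ℂ) (hz : Function.Injective z) :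
    ∃ M > (0:ℝ), ∃ r₀ > (0:ℝ), ∀ r : ℝ, 0 < r → r < r₀ →
      |analyticCapacity (⋃ j, closedBall (z j) r) - (Fintype.card ι * r - Sv z * r^3)|
        ≤ M * r^4 := by
  obtain ⟨M₁, hM₁, r₁, hr₁, H₁⟩ := upper_bound z hz
  obtain ⟨M₂, hM₂, r₂, hr₂, H₂⟩ := lower_bound z hz
  refine ⟨max M₁ M₂, by positivity, min r₁ r₂, by positivity, fun r hr hrr => ?_⟩
  have hr1 : r < r₁ := hrr.trans_le (min_le_left _ _)
  have hr2 : r < r₂ := hrr.trans_le (min_le_right _ _)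
  have hup : ∀ t ∈ { t : ℝ | ∃ (f : ℂ → ℂ) (l w : ℂ),
      DifferentiableOn ℂ f (⋃ j, closedBall (z j) r)ᶜ ∧
      (∀ x ∈ (⋃ j, closedBall (z j) r)ᶜ, ‖f x‖ ≤ 1) ∧
      HasDerivAtInftyOn f (⋃ j, closedBall (z j) r)ᶜ l w ∧ t = ‖w‖ },
      t ≤ Fintype.card ι * r - Sv z * r^3 + M₁ * r^4 := by
    rintro t ⟨f, l, w, h1, h2, h3, rfl⟩
    have hlim : Tendsto (fun ρ : ℝ => Fintype.card ι * ρ - Sv z * ρ^3 + M₁ * ρ^4) (𝓝[>] r)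
        (𝓝 (Fintype.card ι * r - Sv z * r^3 + M₁ * r^4)) := by
      refine Tendsto.mono_left (Continuous.tendsto (by fun_prop) r) nhdsWithin_le_nhds
    refine ge_of_tendsto hlim ?_
    filter_upwards [Ioo_mem_nhdsGT hr1] with ρ hρ
    exact H₁ r ρ hr hρ.1 hρ.2 f l w h1 h2 h3
  obtain ⟨f, l, w, h1, h2, h3, h4⟩ := H₂ r hr hr2
  have hmem : ‖w‖ ∈ { t : ℝ | ∃ (f : ℂ → ℂ) (l w : ℂ),
      DifferentiableOn ℂ f (⋃ j, closedBall (z j) r)ᶜ ∧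
      (∀ x ∈ (⋃ j, closedBall (z j) r)ᶜ, ‖f x‖ ≤ 1) ∧
      HasDerivAtInftyOn f (⋃ j, closedBall (z j) r)ᶜ l w ∧ t = ‖w‖ } :=
    ⟨f, l, w, h1, h2, h3, rfl⟩
  have hle : analyticCapacity (⋃ j, closedBall (z j) r) ≤
      Fintype.card ι * r - Sv z * r^3 + M₁ * r^4 := csSup_le ⟨_, hmem⟩ hup
  have hge : ‖w‖ ≤ analyticCapacity (⋃ j, closedBall (z j) r) := le_csSup ⟨_, hup⟩ hmem
  have hr4 : 0 ≤ r^4 := by positivity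
  have e1 : M₁ * r^4 ≤ max M₁ M₂ * r^4 := by gcongr; exact le_max_left _ _
  have e2 : M₂ * r^4 ≤ max M₁ M₂ * r^4 := by gcongr; exact le_max_right _ _
  rw [abs_le]
  constructor <;> linarith

/-! ### Positivity of the constant -/

/-- The triple products. -/
def trip {ι : Type*} (z : ι → ℂ) (j k l : ι) : ℝ :=
  ((z j - z k)⁻¹ * (starRingEnd ℂ) (z j - z l)⁻¹).re

lemma norm_sq_sum {ι : Type*} [Fintype ι] (c : ι → ℂ) :
    ‖∑ k, c k‖^2 = ∑ k, ∑ l, (c k * (starRingEnd ℂ) (c l)).re := by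
  have h : ‖∑ k, c k‖^2 = ((∑ k, c k) * (starRingEnd ℂ) (∑ k, c k)).re := by
    rw [Complex.mul_conj, Complex.ofReal_re, Complex.normSq_eq_norm_sq]
  rw [h, map_sum, Finset.sum_mul_sum, Complex.re_sum]
  simp only [Complex.re_sum]

lemma Sv_eq {ι : Type*} [Fintype ι] (z : ι → ℂ) : Sv z = ∑ j, ∑ k, ∑ l, trip z j k l := by
  unfold Sv sv trip
  simp only [norm_sq_sum]

lemma sum_subtype_ind {ι : Type*} [Fintype ι] (p : ι → Prop) [DecidablePred p] (g : ι → ℝ) :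
    ∑ j : {j // p j}, g j = ∑ j, (if p j then (1:ℝ) else 0) * g j := by
  rw [← Finset.sum_subtype (Finset.univ.filter p) (by simp) g, Finset.sum_filter]
  refine Finset.sum_congr rfl fun j _ => ?_
  split_ifs <;> simp

lemma Sv_sub {ι : Type*} [Fintype ι] (z : ι → ℂ) (p : ι → Prop) [DecidablePred p] (e : ι → ℝ)
    (he : ∀ j, e j = if p j then (1:ℝ) else 0) :
    Sv (fun j : {j // p j} => z j) = ∑ j, ∑ k, ∑ l, e j * e k * e l * trip z j k l := by
  rw [Sv_eq]
  have h1 : ∀ j k : ι, ∑ l : {j // p j}, trip z j k l = ∑ l, e l * trip z j k l := fun j k => by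
    simp only [he]; exact sum_subtype_ind p (fun l => trip z j k l)
  have h2 : ∀ j : ι, ∑ k : {j // p j}, ∑ l : {j // p j}, trip z j k l
      = ∑ k, e k * ∑ l, e l * trip z j k l := fun j => by
    simp only [h1]
    simp only [he]; exact sum_subtype_ind p (fun k => ∑ l, (if p l then (1:ℝ) else 0) * trip z j k l)
  calc _ = ∑ j : {j // p j}, ∑ k : {j // p j}, ∑ l : {j // p j}, trip z j k l := rfl
    _ = ∑ j, e j * ∑ k, e k * ∑ l, e l * trip z j k l := by
      simp only [h2]
      simp only [he]
      exact sum_subtype_ind p (fun j => ∑ k, (if p k then (1:ℝ) else 0) *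
        ∑ l, (if p l then (1:ℝ) else 0) * trip z j k l)
    _ = _ := by
      simp only [Finset.mul_sum, mul_assoc]

lemma trip_cyc {ι : Type*} (z : ι → ℂ) (hz : Function.Injective z) {j k l : ι}
    (hjk : j ≠ k) (hkl : k ≠ l) (hlj : l ≠ j) :
    0 ≤ trip z j k l + trip z k l j + trip z l j k := by
  unfold trip
  have h1 : z j - z k ≠ 0 := sub_ne_zero.2 (hz.ne hjk)
  have h2 : z j - z l ≠ 0 := sub_ne_zero.2 (hz.ne hlj.symm)
  have h3 : z k - z l ≠ 0 := sub_ne_zero.2 (hz.ne hkl)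
  set u := z j - z k with hu
  set v := z j - z l with hv
  have e1 : z k - z l = v - u := by rw [hu, hv]; ring
  have e2 : z k - z j = - u := by rw [hu]; ring
  have e3 : z l - z j = - v := by rw [hv]; ring
  have e4 : z l - z k = - (v - u) := by rw [hu, hv]; ring
  rw [e1] at h3
  rw [e1, e2, e3, e4]
  have key : ∀ a b : ℂ, (a⁻¹ * (starRingEnd ℂ) b⁻¹).re =
      (a.re * b.re + a.im * b.im) / (Complex.normSq a * Complex.normSq b) := by
    intro a b
    simp only [Complex.mul_re, Complex.inv_re, Complex.inv_im, Complex.conj_re, Complex.conj_im]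
    ring
  rw [key, key, key]
  simp only [Complex.normSq_neg]
  have p1 := Complex.normSq_pos.2 h1
  have p2 := Complex.normSq_pos.2 h2
  have p3 := Complex.normSq_pos.2 h3
  have hU : Complex.normSq u = u.re^2 + u.im^2 := by rw [Complex.normSq_apply]; ring
  have hV : Complex.normSq v = v.re^2 + v.im^2 := by rw [Complex.normSq_apply]; ring
  have hW : Complex.normSq (v - u) = (v.re - u.re)^2 + (v.im - u.im)^2 := by
    rw [Complex.normSq_apply]; simp; ring
  have hsum : (u.re * v.re + u.im * v.im) / (Complex.normSq u * Complex.normSq v) +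
      ((v - u).re * (-u).re + (v - u).im * (-u).im) / (Complex.normSq (v - u) * Complex.normSq u) +
      ((-v).re * (-(v - u)).re + (-v).im * (-(v - u)).im) /
        (Complex.normSq v * Complex.normSq (v - u)) =
      2 * (u.re * v.im - u.im * v.re)^2 /
        (Complex.normSq u * Complex.normSq v * Complex.normSq (v - u)) := by
    have q1 := p1.ne'
    have q2 := p2.ne'
    have q3 := p3.ne'
    simp only [Complex.sub_re, Complex.sub_im, Complex.neg_re, Complex.neg_im]
    field_simp
    rw [hU, hV, hW]
    ring
  rw [hsum]
  positivity

lemma sum_rot {ι : Type*} [Fintype ι] (U : ι → ι → ι → ℝ) :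
    ∑ j, ∑ k, ∑ l, U k l j = ∑ j, ∑ k, ∑ l, U j k l := by
  rw [Finset.sum_comm]
  refine Finset.sum_congr rfl fun j _ => ?_
  rw [Finset.sum_comm]

lemma Sv_strict {ι : Type*} [Fintype ι] (z : ι → ℂ) (hz : Function.Injective z) (e : ι → ℝ)
    (he : ∀ j, e j = 0 ∨ e j = 1) (j₀ k₀ : ι) (hj₀ : e j₀ = 1) (hk₀ : e k₀ = 0) :
    0 < (∑ j, ∑ k, ∑ l, trip z j k l) - (∑ j, ∑ k, ∑ l, e j * e k * e l * trip z j k l)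
      - (∑ j, ∑ k, ∑ l, (1 - e j) * (1 - e k) * (1 - e l) * trip z j k l) := by
  classical
  set χ : ι → ι → ι → ℝ := fun j k l => 1 - e j * e k * e l - (1 - e j) * (1 - e k) * (1 - e l)
    with hχ
  have hχ0 : ∀ j k l, 0 ≤ χ j k l := by
    intro j k l
    simp only [hχ]
    rcases he j with h1 | h1 <;> rcases he k with h2 | h2 <;> rcases he l with h3 | h3 <;>
      rw [h1, h2, h3] <;> norm_num
  have heq : (∑ j, ∑ k, ∑ l, trip z j k l) - (∑ j, ∑ k, ∑ l, e j * e k * e l * trip z j k l)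
      - (∑ j, ∑ k, ∑ l, (1 - e j) * (1 - e k) * (1 - e l) * trip z j k l) =
      ∑ j, ∑ k, ∑ l, χ j k l * trip z j k l := by
    simp only [← Finset.sum_sub_distrib]
    refine Finset.sum_congr rfl fun j _ => Finset.sum_congr rfl fun k _ =>
      Finset.sum_congr rfl fun l _ => ?_
    simp only [hχ]; ring
  rw [heq]
  set U : ι → ι → ι → ℝ := fun j k l => if k = l then 0 else χ j k l * trip z j k l with hU
  have hsplit : ∑ j, ∑ k, ∑ l, χ j k l * trip z j k l =
      (∑ j, ∑ k, χ j k k * trip z j k k) + ∑ j, ∑ k, ∑ l, U j k l := by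
    simp only [← Finset.sum_add_distrib]
    refine Finset.sum_congr rfl fun j _ => Finset.sum_congr rfl fun k _ => ?_
    have h1 : χ j k k * trip z j k k = ∑ l, if k = l then χ j k l * trip z j k l else 0 := by
      simp
    rw [h1, ← Finset.sum_add_distrib]
    refine Finset.sum_congr rfl fun l _ => ?_
    simp only [hU]
    split_ifs <;> simp
  have htd : ∀ j k, 0 ≤ trip z j k k := by
    intro j k
    unfold trip
    rw [Complex.mul_conj, Complex.ofReal_re]
    exact Complex.normSq_nonneg _
  have hdiag : 0 < ∑ j, ∑ k, χ j k k * trip z j k k := by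
    refine Finset.sum_pos' (fun j _ => Finset.sum_nonneg fun k _ => mul_nonneg (hχ0 _ _ _)
      (htd _ _)) ⟨j₀, Finset.mem_univ _, ?_⟩
    refine Finset.sum_pos' (fun k _ => mul_nonneg (hχ0 _ _ _)
      (htd _ _)) ⟨k₀, Finset.mem_univ _, ?_⟩
    have hne : j₀ ≠ k₀ := by
      rintro rfl
      rw [hj₀] at hk₀; norm_num at hk₀
    have h1 : χ j₀ k₀ k₀ = 1 := by simp only [hχ]; rw [hj₀, hk₀]; norm_num
    rw [h1, one_mul]
    unfold trip
    rw [Complex.mul_conj, Complex.ofReal_re]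
    exact Complex.normSq_pos.2 (inv_ne_zero (sub_ne_zero.2 (hz.ne hne)))
  have hW : 0 ≤ ∑ j, ∑ k, ∑ l, U j k l := by
    have h3 : 3 * ∑ j, ∑ k, ∑ l, U j k l =
        ∑ j, ∑ k, ∑ l, (U j k l + U k l j + U l j k) := by
      simp only [Finset.sum_add_distrib]
      rw [sum_rot U, ← sum_rot (fun j k l => U l j k)]
      ring
    have h4 : 0 ≤ ∑ j, ∑ k, ∑ l, (U j k l + U k l j + U l j k) := by
      refine Finset.sum_nonneg fun j _ => Finset.sum_nonneg fun k _ =>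
        Finset.sum_nonneg fun l _ => ?_
      have hz1 : ∀ a b, U a a b = 0 := fun a b => by simp [hU, trip]
      have hz2 : ∀ a b, U a b a = 0 := fun a b => by simp [hU, trip]
      have hz3 : ∀ a b, U a b b = 0 := fun a b => by simp [hU]
      by_cases hjk : j = k
      · subst hjk; rw [hz1, hz2, hz3]; norm_num
      by_cases hkl : k = l
      · subst hkl; rw [hz1, hz2, hz3]; norm_num
      by_cases hlj : l = j
      · subst hlj; rw [hz1, hz2, hz3]; norm_num
      have e1 : U j k l = χ j k l * trip z j k l := if_neg hkl
      have e2 : U k l j = χ j k l * trip z k l j := by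
        simp only [hU]; rw [if_neg hlj]; simp only [hχ]; ring
      have e3 : U l j k = χ j k l * trip z l j k := by
        simp only [hU]; rw [if_neg hjk]; simp only [hχ]; ring
      rw [e1, e2, e3, ← mul_add, ← mul_add]
      exact mul_nonneg (hχ0 _ _ _) (trip_cyc z hz hjk hkl hlj)
    linarith
  rw [hsplit]
  linarith

lemma ratio_final {N S T C A B r M : ℝ} (hN : 1 ≤ N) (hT : 0 ≤ T) (hC0 : 0 ≤ C)
    (hC : C * N = S - T) (hr : 0 < r)
    (hM : 0 ≤ M) (hr1 : r ≤ 1) (hrs : (T + M) * r ≤ 1 / 2)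
    (hA : |A - (N * r - S * r^3)| ≤ M * r^4) (hB : |B - (N * r - T * r^3)| ≤ M * r^4) :
    |A / B - (1 - C * r^2)| ≤ (2 * (2 * M + C * T + C * M)) * r^3 := by
  rw [abs_le] at hA hB
  have hr2 : r^2 ≤ r := by nlinarith
  have hr3 : r^3 ≤ r^2 := pow_le_pow_of_le_one hr.le hr1 (by norm_num)
  have hr4 : r^4 ≤ r^2 := pow_le_pow_of_le_one hr.le hr1 (by norm_num)
  have hBlow : r / 2 ≤ B := by
    have h1 : T * r^3 ≤ T * r^2 := by gcongr
    have h2 : M * r^4 ≤ M * r^2 := by gcongr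
    have h3 : (T + M) * r * r ≤ 1 / 2 * r := by gcongr
    nlinarith
  have hB0 : 0 < B := by linarith
  have heq : A / B - (1 - C * r^2) = (A - B * (1 - C * r^2)) / B := by
    field_simp
  rw [heq, abs_div, abs_of_pos hB0, div_le_iff₀ hB0]
  set a := A - (N * r - S * r^3) with ha
  set b := B - (N * r - T * r^3) with hb
  have hAe : A = N * r - S * r^3 + a := by rw [ha]; ring
  have hBe : B = N * r - T * r^3 + b := by rw [hb]; ring
  have hnum : A - B * (1 - C * r^2) = a - b - C * T * r^5 + C * r^2 * b := by
    rw [hAe, hBe]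
    linear_combination r^3 * hC
  have hr5 : r^5 ≤ r^4 := pow_le_pow_of_le_one hr.le hr1 (by norm_num)
  have hr5' : 0 ≤ r^5 := by positivity
  have hr4' : 0 ≤ r^4 := by positivity
  have hr21 : r^2 ≤ 1 := by linarith
  have hCT : 0 ≤ C * T := by positivity
  have hb' : |C * r^2 * b| ≤ C * M * r^4 := by
    rw [abs_mul, abs_of_nonneg (by positivity : 0 ≤ C * r^2)]
    have : |b| ≤ M * r^4 := abs_le.2 hB
    calc _ ≤ C * 1 * (M * r^4) := by gcongr
      _ = _ := by ring
  rw [abs_le] at hb'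
  have hct : C * T * r^5 ≤ C * T * r^4 := by gcongr
  have hct' : 0 ≤ C * T * r^5 := by positivity
  have hfin : (2 * M + C * T + C * M) * r^4 ≤ 2 * (2 * M + C * T + C * M) * r^3 * B := by
    calc (2 * M + C * T + C * M) * r^4 = 2 * (2 * M + C * T + C * M) * r^3 * (r / 2) := by ring
      _ ≤ _ := by gcongr
  refine le_trans ?_ hfin
  rw [hnum, abs_le]
  constructor <;> nlinarith

/-- Fix distinct points `z₁, …, zₙ` and `m ∈ {1, …, n−1}`. Then there is a
constant `C > 0` (depending only on `n`, `m` and the points) with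
`R(Z,r,m) = 1 − C r² + O(r³)` as `r → 0⁺`, where
`R(Z,r,m) = γ(⋃ⱼ D̄(zⱼ,r)) / (γ(⋃_{j<m} D̄(zⱼ,r)) + γ(⋃_{j≥m} D̄(zⱼ,r)))`. -/
theorem ratio_asymptotics (n m : ℕ) (hm : 1 ≤ m) (hmn : m < n)
    (z : Fin n → ℂ) (hz : Function.Injective z) :
    ∃ C > (0:ℝ), ∃ M > (0:ℝ), ∃ r₀ > (0:ℝ), ∀ r : ℝ, 0 < r → r < r₀ →
      |analyticCapacity (⋃ j, closedBall (z j) r) /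
          (analyticCapacity (⋃ j ∈ {j : Fin n | (j : ℕ) < m}, closedBall (z j) r) +
            analyticCapacity (⋃ j ∈ {j : Fin n | m ≤ (j : ℕ)}, closedBall (z j) r)) -
        (1 - C * r ^ 2)| ≤ M * r ^ 3 := by
  classical
  let e : Fin n → ℝ := fun j => if (j : ℕ) < m then 1 else 0
  have hz1 : Function.Injective (fun j : {j : Fin n // (j : ℕ) < m} => z j) :=
    hz.comp Subtype.val_injective
  have hz2 : Function.Injective (fun j : {j : Fin n // m ≤ (j : ℕ)} => z j) :=
    hz.comp Subtype.val_injective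
  obtain ⟨M₀, hM₀, r₀, hr₀, H₀⟩ := capacity_asymp z hz
  obtain ⟨M₁, hM₁, r₁, hr₁, H₁⟩ := capacity_asymp _ hz1
  obtain ⟨M₂, hM₂, r₂, hr₂, H₂⟩ := capacity_asymp _ hz2
  have hS1 := Sv_sub z (fun j : Fin n => (j : ℕ) < m) e (fun j => rfl)
  have hS2 := Sv_sub z (fun j : Fin n => m ≤ (j : ℕ)) (fun j => 1 - e j) (fun j => by
    simp only [e]
    by_cases h : (j : ℕ) < m
    · rw [if_pos h, if_neg (by omega)]; norm_num
    · rw [if_neg h, if_pos (by omega)]; norm_num)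
  have hpos := Sv_strict z hz e (fun j => by
      simp only [e]
      by_cases h : (j : ℕ) < m
      · right; rw [if_pos h]
      · left; rw [if_neg h])
    ⟨0, by omega⟩ ⟨m, hmn⟩ (if_pos (by simp; omega)) (if_neg (by simp))
  rw [← Sv_eq, ← hS1, ← hS2] at hpos
  set S := Sv z with hS
  set T₁ := Sv (fun j : {j : Fin n // (j : ℕ) < m} => z j) with hT₁
  set T₂ := Sv (fun j : {j : Fin n // m ≤ (j : ℕ)} => z j) with hT₂
  have hT10 : 0 ≤ T₁ := Finset.sum_nonneg fun k _ => by positivity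
  have hT20 : 0 ≤ T₂ := Finset.sum_nonneg fun k _ => by positivity
  have hn : (1:ℝ) ≤ n := by exact_mod_cast (by omega : 1 ≤ n)
  have hn0 : (0:ℝ) < n := by linarith
  have hcard : (Fintype.card {j : Fin n // (j : ℕ) < m} : ℝ) +
      Fintype.card {j : Fin n // m ≤ (j : ℕ)} = n := by
    have h1 := Fintype.card_subtype_compl (fun j : Fin n => (j : ℕ) < m)
    have h2 : Fintype.card {j : Fin n // ¬ (j : ℕ) < m} =
        Fintype.card {j : Fin n // m ≤ (j : ℕ)} :=
      Fintype.card_congr (Equiv.subtypeEquivRight fun j => not_lt)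
    have h3 := Fintype.card_subtype_le (fun j : Fin n => (j : ℕ) < m)
    rw [h2] at h1
    rw [Fintype.card_fin] at h1 h3
    exact_mod_cast (by omega)
  set C : ℝ := (S - T₁ - T₂) / n with hC
  have hC0 : 0 < C := div_pos hpos hn0
  set M : ℝ := M₀ + M₁ + M₂ with hM
  have hMpos : 0 < M := by positivity
  set L : ℝ := 2 * (T₁ + T₂ + M) with hL
  have hL0 : 0 < L := by positivity
  refine ⟨C, hC0, 2 * (2 * M + C * (T₁ + T₂) + C * M), by positivity,
    min (min r₀ r₁) (min r₂ (min 1 L⁻¹)), by positivity, fun r hr hrr => ?_⟩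
  simp only [lt_min_iff] at hrr
  obtain ⟨⟨a0, a1⟩, a2, a3, a4⟩ := hrr
  have h0 := H₀ r hr a0
  have h1 := H₁ r hr a1
  have h2 := H₂ r hr a2
  have u1 : (⋃ j ∈ {j : Fin n | (j : ℕ) < m}, closedBall (z j) r) =
      ⋃ j : {j : Fin n // (j : ℕ) < m}, closedBall (z j) r :=
    biUnion_eq_iUnion {j : Fin n | (j : ℕ) < m} (fun j _ => closedBall (z j) r)
  have u2 : (⋃ j ∈ {j : Fin n | m ≤ (j : ℕ)}, closedBall (z j) r) =
      ⋃ j : {j : Fin n // m ≤ (j : ℕ)}, closedBall (z j) r :=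
    biUnion_eq_iUnion {j : Fin n | m ≤ (j : ℕ)} (fun j _ => closedBall (z j) r)
  rw [u1, u2]
  have hr4 : 0 ≤ r^4 := by positivity
  rw [Fintype.card_fin] at h0
  refine ratio_final (N := n) (S := S) (T := T₁ + T₂) hn (by positivity) hC0.le ?_ hr hMpos.le
    a3.le ?_ ?_ ?_
  · rw [hC]; field_simp; ring
  · have : L * r ≤ 1 := by
      calc L * r ≤ L * L⁻¹ := by gcongr
        _ = 1 := mul_inv_cancel₀ hL0.ne'
    rw [hL] at this
    linarith
  · refine h0.trans ?_
    gcongr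
    linarith
  · rw [← hcard]
    rw [abs_le] at h1 h2 ⊢
    have : 0 ≤ M₀ * r^4 := by positivity
    rw [hM]
    constructor <;> nlinarith
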